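/- Let [x_k] be a nonsingular Gaussian sequence with positive definite joint covariance matrix C. Then [x_k] is CM_F if and only if C⁻¹ has the CM_F form, i.e., the d×d blocks of C⁻¹ satisfy (C⁻¹)_{i,j} = 0 for all i, j ∈ [0,N] with |i − j| ≥ 2 and 0 ∉ {i, j}. -/

import Mathlib

open MeasureTheory ProbabilityTheory

variable {Ω : Type*}

/-- The σ-field generated by the random variables `x k`, `k ∈ S`. -/
noncomputable def sigmaOf [MeasurableSpace Ω] {d : ℕ} (x : ℕ → Ω → (Fin d → ℝ)) (S : Set ℕ) :
    MeasurableSpace Ω :=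
  ⨆ k ∈ S, MeasurableSpace.comap (x k) inferInstance

lemma sigmaOf_le [m : MeasurableSpace Ω] {d : ℕ} {x : ℕ → Ω → (Fin d → ℝ)}
    (hx : ∀ k, Measurable (x k)) (S : Set ℕ) : sigmaOf x S ≤ m :=
  iSup_le fun k => iSup_le fun _ => (hx k).comap_le

/-- `[x_k]` is `CM_c` over `[0,N]` (`CM_F` for `c = 0`, `CM_L` for `c = N`): for every
`j ∈ [0,N]`, the σ-fields generated by `{x_k : k ∈ [j+1,N]} \ {x_c}` and by
`{x_k : k ∈ [0,j-1]} \ {x_c}` are conditionally independent given `σ(x_j, x_c)`. -/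
def IsCM [MeasurableSpace Ω] [StandardBorelSpace Ω] {d : ℕ} (N c : ℕ)
    (P : Measure Ω) [IsFiniteMeasure P]
    (x : ℕ → Ω → (Fin d → ℝ)) (hx : ∀ k, Measurable (x k)) : Prop :=
  ∀ j ≤ N, CondIndep (sigmaOf x {j, c})
    (sigmaOf x {k | j < k ∧ k ≤ N ∧ k ≠ c})
    (sigmaOf x {k | k < j ∧ k ≠ c})
    (sigmaOf_le hx _) P

/-- A random vector is (jointly) Gaussian iff every linear functional of it has a
(possibly degenerate) one-dimensional Gaussian distribution (Cramér–Wold). -/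
def IsGaussianVec {ι : Type*} [Fintype ι] [MeasurableSpace Ω]
    (X : Ω → (ι → ℝ)) (P : Measure Ω) : Prop :=
  ∀ a : ι → ℝ, ∃ (mu : ℝ) (v : NNReal),
    Measure.map (fun ω => ∑ i, a i * X ω i) P = gaussianReal mu v

/-- The stacked vector `(x_0', …, x_N')' ∈ ℝ^{(N+1)d}` of the sequence. -/
def stacked {d : ℕ} (N : ℕ) [MeasurableSpace Ω] (x : ℕ → Ω → (Fin d → ℝ)) (ω : Ω) :
    Fin (N + 1) × Fin d → ℝ :=
  fun p => x p.1 ω p.2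

section BlockInverse

lemma Matrix.inv_apply_eq_zero_of_block {κ : Type*} [Fintype κ] [DecidableEq κ]
    {M : Matrix κ κ ℝ} (hM : IsUnit M) {p : κ → Prop}
    (h : ∀ a b, p a → ¬ p b → M a b = 0) {a b : κ} (ha : p a) (hb : ¬ p b) :
    M⁻¹ a b = 0 := by
  classical
  have := hM.invertible
  refine blockTriangular_inv_of_blockTriangular (b := fun i => if p i then 1 else 0)
    (fun i j hij => ?_) (by simp [ha, hb])
  have : p i ∧ ¬ p j := by
    by_cases hi : p i <;> by_cases hj : p j <;> simp_all
  exact h i j this.1 this.2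

lemma Matrix.inv_apply_eq_zero_iff_block {κ : Type*} [Fintype κ] [DecidableEq κ]
    {M : Matrix κ κ ℝ} (hM : IsUnit M) (p : κ → Prop) :
    (∀ a b, p a → ¬ p b → M⁻¹ a b = 0) ↔ ∀ a b, p a → ¬ p b → M a b = 0 := by
  refine ⟨fun h a b ha hb => ?_, fun h a b ha hb => inv_apply_eq_zero_of_block hM h ha hb⟩
  have := inv_apply_eq_zero_of_block (isUnit_nonsing_inv_iff.2 hM) h ha hb
  rwa [nonsing_inv_nonsing_inv _ ((isUnit_iff_isUnit_det M).1 hM)] at this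

/-- The coefficients `L` of the residuals of the coordinates in the range of `f` after projecting
onto the other coordinates, in terms of the covariance matrix `C`. -/
lemma Matrix.PosDef.exists_residual_matrix {ι κ : Type*} [Fintype ι] [DecidableEq ι]
    [Fintype κ] [DecidableEq κ] {C : Matrix ι ι ℝ} (hC : C.PosDef) {f : κ → ι}
    (hf : Function.Injective f) :
    ∃ L : Matrix κ ι ℝ, L.submatrix id f = 1 ∧ (∀ k s, (∀ k', f k' ≠ s) → (L * C) k s = 0) ∧
      L * C * L.transpose = (C⁻¹.submatrix f f)⁻¹ := by
  have hCu : IsUnit C.det := (isUnit_iff_isUnit_det C).1 hC.isUnit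
  have hQ : IsUnit (C⁻¹.submatrix f f).det :=
    (isUnit_iff_isUnit_det _).1 (hC.inv.submatrix hf).isUnit
  have hL1 : ((C⁻¹.submatrix f f)⁻¹ * C⁻¹.submatrix f id).submatrix id f = 1 :=
    nonsing_inv_mul _ hQ
  have hLC : (C⁻¹.submatrix f f)⁻¹ * C⁻¹.submatrix f id * C =
      (C⁻¹.submatrix f f)⁻¹ * (1 : Matrix ι ι ℝ).submatrix f id := by
    rw [Matrix.mul_assoc, ← nonsing_inv_mul C hCu]
    rfl
  refine ⟨(C⁻¹.submatrix f f)⁻¹ * C⁻¹.submatrix f id, hL1, fun k s hs => ?_, ?_⟩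
  · rw [hLC, Matrix.mul_apply]
    exact Finset.sum_eq_zero fun k' _ => by simp [hs k']
  · have h (L : Matrix κ ι ℝ) : (1 : Matrix ι ι ℝ).submatrix f id * L.transpose =
        (L.submatrix id f).transpose := by
      ext a b
      simp [Matrix.mul_apply, one_apply]
    rw [hLC, Matrix.mul_assoc, h, hL1, transpose_one, Matrix.mul_one]

end BlockInverse

section CondIndep

variable {m' m₁ m₂ : MeasurableSpace Ω} {mΩ : MeasurableSpace Ω}
  [StandardBorelSpace Ω] {P : Measure Ω}

/-- Conditional independence given `m'` is stable under adjoining `m'`. -/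
lemma condIndep_sup_left [IsFiniteMeasure P] (hm' : m' ≤ mΩ) (hm₁ : m₁ ≤ mΩ) (hm₂ : m₂ ≤ mΩ)
    (h : CondIndep m' m₁ m₂ hm' P) : CondIndep m' (m₁ ⊔ m') m₂ hm' P := by
  have hpi : IsPiSystem (Set.image2 (· ∩ ·) {s | MeasurableSet[m₁] s}
      {s | MeasurableSet[m'] s}) := by
    rintro _ ⟨s, hs, t, ht, rfl⟩ _ ⟨u, hu, v, hv, rfl⟩ -
    exact ⟨s ∩ u, MeasurableSet.inter hs hu, t ∩ v, MeasurableSet.inter ht hv,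
      (Set.inter_inter_inter_comm _ _ _ _).symm ▸ rfl⟩
  have hmeas : ∀ s ∈ Set.image2 (· ∩ ·) {s | MeasurableSet[m₁] s} {s | MeasurableSet[m'] s},
      MeasurableSet s := by
    rintro _ ⟨s, hs, t, ht, rfl⟩
    exact (hm₁ s hs).inter (hm' t ht)
  have hgen : m₁ ⊔ m' = MeasurableSpace.generateFrom
      (Set.image2 (· ∩ ·) {s | MeasurableSet[m₁] s} {s | MeasurableSet[m'] s}) := by
    refine le_antisymm (sup_le (fun s hs => ?_) (fun s hs => ?_))
      (MeasurableSpace.generateFrom_le ?_)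
    · exact MeasurableSpace.measurableSet_generateFrom ⟨s, hs, Set.univ, .univ, by simp⟩
    · exact MeasurableSpace.measurableSet_generateFrom ⟨Set.univ, .univ, s, hs, by simp⟩
    · rintro _ ⟨s, hs, t, ht, rfl⟩
      exact MeasurableSet.inter (le_sup_left (a := m₁) s hs) (le_sup_right (a := m₁) t ht)
  refine CondIndepSets.condIndep (sup_le hm₁ hm') hm₂ hpi
    (@MeasurableSpace.isPiSystem_measurableSet _ m₂) hgen
    (@MeasurableSpace.generateFrom_measurableSet _ m₂).symm ?_
  rw [condIndepSets_iff m' hm' _ {s | MeasurableSet[m₂] s} hmeas (fun s hs => hm₂ s hs)]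
  rintro _ u ⟨s, hs, t, ht, rfl⟩ hu
  have key := (condIndep_iff m' m₁ m₂ hm' hm₁ hm₂ P).1 h s u hs hu
  have aux : ∀ v, MeasurableSet v →
      P⟦v ∩ t | m'⟧ =ᵐ[P] t.indicator (P⟦v | m'⟧) := by
    intro v hv
    rw [Set.inter_comm, ← Set.indicator_indicator]
    exact condExp_indicator ((integrable_const _).indicator hv) ht
  have h1 := aux _ ((hm₁ s hs).inter (hm₂ u hu))
  have h2 := aux _ (hm₁ s hs)
  rw [Set.inter_right_comm] at h1
  filter_upwards [key, h1, h2] with ω k1 k2 k3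
  simp only [Pi.mul_apply] at k1 ⊢
  rw [k2, k3]
  by_cases hω : ω ∈ t <;> simp [hω, k1]

lemma condIndep_sup_sup [IsFiniteMeasure P] (hm' : m' ≤ mΩ) (hm₁ : m₁ ≤ mΩ) (hm₂ : m₂ ≤ mΩ)
    (h : CondIndep m' m₁ m₂ hm' P) : CondIndep m' (m₁ ⊔ m') (m₂ ⊔ m') hm' P :=
  (condIndep_sup_left hm' hm₂ (sup_le hm₁ hm') (condIndep_sup_left hm' hm₁ hm₂ h).symm).symm

/-- Conditioning on a σ-field independent of `m₁ ⊔ m₂` does not affect the independence of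
`m₁` and `m₂`. -/
lemma condIndep_iff_indep_of_indep_sup [IsProbabilityMeasure P] (hm' : m' ≤ mΩ) (hm₁ : m₁ ≤ mΩ)
    (hm₂ : m₂ ≤ mΩ) (h : Indep (m₁ ⊔ m₂) m' P) :
    CondIndep m' m₁ m₂ hm' P ↔ Indep m₁ m₂ P := by
  rw [condIndep_iff m' m₁ m₂ hm' hm₁ hm₂, Indep_iff]
  have aux : ∀ s, MeasurableSet[m₁ ⊔ m₂] s → P⟦s | m'⟧ =ᵐ[P] fun _ => P.real s := by
    intro s hs
    have := condExp_indep_eq (sup_le hm₁ hm₂) hm' (f := s.indicator fun _ => (1 : ℝ))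
      ((@stronglyMeasurable_const _ _ (m₁ ⊔ m₂) _ _).indicator hs) h
    rwa [integral_indicator_const _ (sup_le hm₁ hm₂ s hs), smul_eq_mul, mul_one] at this
  refine forall₂_congr fun s t => forall₂_congr fun hs ht => ?_
  have hs' := le_sup_left (b := m₂) s hs
  have ht' := le_sup_right (a := m₁) t ht
  have e : P⟦s ∩ t | m'⟧ =ᵐ[P] P⟦s | m'⟧ * P⟦t | m'⟧ ↔
      P.real (s ∩ t) = P.real s * P.real t := by
    refine ⟨fun hst => ?_, fun hst => ?_⟩
    · obtain ⟨ω, h1, h2, h3, h4⟩ :=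
        (hst.and ((aux _ (MeasurableSet.inter hs' ht')).and ((aux s hs').and (aux t ht')))).exists
      simpa only [h2, Pi.mul_apply, h3, h4] using h1
    · filter_upwards [aux _ (MeasurableSet.inter hs' ht'), aux s hs', aux t ht'] with ω h2 h3 h4
      rw [h2, Pi.mul_apply, h3, h4, hst]
  rw [e, measureReal_def, measureReal_def, measureReal_def, ← ENNReal.toReal_mul,
    ENNReal.toReal_eq_toReal_iff' (measure_ne_top _ _)
      (ENNReal.mul_ne_top (measure_ne_top _ _) (measure_ne_top _ _))]

end CondIndep

section Gaussian

/-- The σ-field generated by the real random variables `X i`, `i ∈ T`. -/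
def coordSigma {ι : Type*} (X : ι → Ω → ℝ) (T : Set ι) : MeasurableSpace Ω :=
  ⨆ i ∈ T, MeasurableSpace.comap (X i) inferInstance

lemma measurable_coordSigma {ι : Type*} (X : ι → Ω → ℝ) {T : Set ι} {i : ι} (hi : i ∈ T) :
    Measurable[coordSigma X T] (X i) :=
  Measurable.of_comap_le (le_iSup₂_of_le i hi le_rfl)

lemma coordSigma_le {ι : Type*} {X : ι → Ω → ℝ} {T : Set ι} {m : MeasurableSpace Ω}
    (h : ∀ i ∈ T, Measurable[m] (X i)) : coordSigma X T ≤ m :=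
  iSup₂_le fun i hi => (h i hi).comap_le

lemma coordSigma_union {ι : Type*} (X : ι → Ω → ℝ) (S T : Set ι) :
    coordSigma X (S ∪ T) = coordSigma X S ⊔ coordSigma X T :=
  iSup_union

lemma coordSigma_eq_comap {ι : Type*} (X : ι → Ω → ℝ) (T : Set ι) :
    coordSigma X T = MeasurableSpace.comap (fun ω (i : T) => X i ω) inferInstance := by
  refine le_antisymm (coordSigma_le fun i hi => ?_) (Measurable.comap_le ?_)
  · exact (measurable_pi_apply (X := fun _ : T => ℝ) ⟨i, hi⟩).comp (comap_measurable _)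
  · exact @measurable_pi_lambda _ _ _ (coordSigma X T) _ _
      fun i => measurable_coordSigma X i.2

variable {mΩ : MeasurableSpace Ω} {P : Measure Ω} {ι : Type*} [Fintype ι]
  {X : ι → Ω → ℝ} {C : Matrix ι ι ℝ}

lemma covariance_mulVec (hX : HasGaussianLaw (fun ω i => X i ω) P)
    (hC : ∀ p q, C p q = cov[X p, X q; P]) {κ κ' : Type*}
    (G : Matrix κ ι ℝ) (H : Matrix κ' ι ℝ) (k : κ) (l : κ') :
    cov[fun ω => G.mulVec (fun i => X i ω) k, fun ω => H.mulVec (fun i => X i ω) l; P] =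
      (G * C * H.transpose) k l := by
  have hmem (c : ℝ) (i : ι) : MemLp (fun ω => c * X i ω) 2 P := (hX.eval i).memLp_two.const_mul c
  have := hX.isProbabilityMeasure
  simp only [Matrix.mulVec, dotProduct]
  rw [covariance_fun_sum_fun_sum (fun i => hmem _ i) (fun i => hmem _ i)]
  simp only [covariance_const_mul_left, covariance_const_mul_right, ← hC, Matrix.mul_apply,
    Matrix.transpose_apply, Finset.sum_mul]
  rw [Finset.sum_comm]
  exact Finset.sum_congr rfl fun _ _ => Finset.sum_congr rfl fun _ _ => by ring

lemma indepFun_mulVec_iff (hX : HasGaussianLaw (fun ω i => X i ω) P)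
    (hC : ∀ p q, C p q = cov[X p, X q; P]) {κ κ' : Type*} [Fintype κ] [Fintype κ']
    (G : Matrix κ ι ℝ) (H : Matrix κ' ι ℝ) :
    IndepFun (fun ω => G.mulVec fun i => X i ω) (fun ω => H.mulVec fun i => X i ω) P ↔
      G * C * H.transpose = 0 := by
  refine ⟨fun h => ?_, fun h => ?_⟩
  · ext k l
    rw [← covariance_mulVec hX hC]
    exact (h.comp (measurable_pi_apply k) (measurable_pi_apply l)).covariance_eq_zero
      ((hX.map_fun (LinearMap.toContinuousLinearMap G.mulVecLin)).eval k).memLp_two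
      ((hX.map_fun (LinearMap.toContinuousLinearMap H.mulVecLin)).eval l).memLp_two
  · refine HasGaussianLaw.indepFun_of_covariance_eval
      (X := fun k ω => G.mulVec (fun i => X i ω) k) (Y := fun l ω => H.mulVec (fun i => X i ω) l)
      (hX.map_fun ((LinearMap.toContinuousLinearMap G.mulVecLin).prod
        (LinearMap.toContinuousLinearMap H.mulVecLin))) fun k l => ?_
    rw [covariance_mulVec hX hC, h]
    rfl

/-- For a nonsingular Gaussian vector, the coordinates in `A` and in `B` are conditionally
independent given all the others iff the `A × B` block of the precision matrix vanishes. -/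
theorem condIndep_coordSigma_iff_inv_eq_zero [StandardBorelSpace Ω] [IsProbabilityMeasure P]
    [DecidableEq ι] (hXm : ∀ i, Measurable (X i)) (hX : HasGaussianLaw (fun ω i => X i ω) P)
    (hC : ∀ p q, C p q = cov[X p, X q; P]) (hCpd : C.PosDef) {A B : Set ι} (hAB : Disjoint A B) :
    CondIndep (coordSigma X (A ∪ B)ᶜ) (coordSigma X A) (coordSigma X B)
        (coordSigma_le fun i _ => hXm i) P ↔
      ∀ a ∈ A, ∀ b ∈ B, C⁻¹ a b = 0 := by
  classical
  have hQ : IsUnit (C⁻¹.submatrix (Subtype.val : ↥(A ∪ B) → ι) Subtype.val) :=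
    (hCpd.inv.submatrix Subtype.val_injective).isUnit
  obtain ⟨L, hL1, hLC, hLCL⟩ := hCpd.exists_residual_matrix
    (Subtype.val_injective : Function.Injective (Subtype.val : ↥(A ∪ B) → ι))
  let R : ↥(A ∪ B) → Ω → ℝ := fun u ω => L.mulVec (fun i => X i ω) u
  have hRm : ∀ u, Measurable (R u) := fun u =>
    Finset.measurable_sum _ fun i _ => (hXm i).const_mul _
  have hR (u : ↥(A ∪ B)) (ω : Ω) : R u ω = X u ω + ∑ s : {i // i ∉ A ∪ B}, L u s * X s ω := by
    have hsum := Fintype.sum_subtype_add_sum_subtype (fun i => i ∈ A ∪ B)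
      (fun i => L u i * X i ω)
    have hu : ∑ v : ↥(A ∪ B), L u v * X v ω = X u ω := by
      have hLv (v : ↥(A ∪ B)) : L u v = (1 : Matrix ↥(A ∪ B) ↥(A ∪ B) ℝ) u v := by
        rw [← hL1]
        rfl
      simp [hLv, Matrix.one_apply]
    rw [← hu]
    change ∑ i, L u i * X i ω = _
    convert hsum.symm
  let pre (T : Set ι) : Set ↥(A ∪ B) := Subtype.val ⁻¹' T
  have hsig (T : Set ι) : coordSigma R (pre T) ≤ mΩ := coordSigma_le fun u _ => hRm u
  have hsigX (T : Set ι) : coordSigma X T ≤ mΩ := coordSigma_le fun i _ => hXm i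
  have hcomb (u : ↥(A ∪ B)) : Measurable[coordSigma X (A ∪ B)ᶜ]
      fun ω => ∑ s : {i // i ∉ A ∪ B}, L u s * X s ω :=
    Finset.measurable_sum _ fun s _ => (measurable_coordSigma X s.2).const_mul _
  have hRX (T : Set ι) : coordSigma R (pre T) ≤ coordSigma X T ⊔ coordSigma X (A ∪ B)ᶜ := by
    refine coordSigma_le fun u hu => ?_
    rw [funext (hR u)]
    exact ((measurable_coordSigma X hu).mono le_sup_left le_rfl).add
      ((hcomb u).mono le_sup_right le_rfl)
  have hXR (T : Set ι) (hT : T ⊆ A ∪ B) :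
      coordSigma X T ≤ coordSigma R (pre T) ⊔ coordSigma X (A ∪ B)ᶜ := by
    refine coordSigma_le fun i hi => ?_
    have e : X i = fun ω => R ⟨i, hT hi⟩ ω -
        ∑ s : {i // i ∉ A ∪ B}, L ⟨i, hT hi⟩ s * X s ω := by
      funext ω
      rw [hR, add_sub_cancel_right]
    rw [e]
    have hu : (⟨i, hT hi⟩ : ↥(A ∪ B)) ∈ pre T := hi
    exact ((measurable_coordSigma R hu).mono le_sup_left le_rfl).sub
      ((hcomb _).mono le_sup_right le_rfl)
  have hindep : Indep (coordSigma R (pre A) ⊔ coordSigma R (pre B)) (coordSigma X (A ∪ B)ᶜ) P := by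
    rw [← coordSigma_union, coordSigma_eq_comap, coordSigma_eq_comap X]
    have := (indepFun_mulVec_iff hX hC
      (L.submatrix (Subtype.val : ↥(pre A ∪ pre B) → ↥(A ∪ B)) id)
      ((1 : Matrix ι ι ℝ).submatrix (Subtype.val : ↥(A ∪ B)ᶜ → ι) id)).2 (by
        have : L.submatrix (Subtype.val : ↥(pre A ∪ pre B) → ↥(A ∪ B)) id * C =
            (L * C).submatrix Subtype.val id := rfl
        rw [this]
        ext k s
        rw [Matrix.mul_apply]
        refine Finset.sum_eq_zero fun i _ => ?_
        by_cases hi : i = s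
        · subst hi
          simp [hLC k.1 s fun u h => s.2 (h ▸ u.2)]
        · simp [Ne.symm hi])
    have e : (fun ω => ((1 : Matrix ι ι ℝ).submatrix (Subtype.val : ↥(A ∪ B)ᶜ → ι) id).mulVec
        fun i => X i ω) = fun ω (s : ↥(A ∪ B)ᶜ) => X s ω := by
      funext ω s
      simp [Matrix.mulVec, dotProduct, Matrix.one_apply]
    rw [e] at this
    exact this
  calc CondIndep (coordSigma X (A ∪ B)ᶜ) (coordSigma X A) (coordSigma X B) (hsigX _) P
    _ ↔ CondIndep (coordSigma X (A ∪ B)ᶜ) (coordSigma R (pre A)) (coordSigma R (pre B))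
        (hsigX _) P :=
      ⟨fun h => condIndep_of_condIndep_of_le_left (condIndep_of_condIndep_of_le_right
          (condIndep_sup_sup (hsigX _) (hsigX _) (hsigX _) h) (hRX B)) (hRX A),
        fun h => condIndep_of_condIndep_of_le_left (condIndep_of_condIndep_of_le_right
          (condIndep_sup_sup (hsigX _) (hsig _) (hsig _) h)
          (hXR B Set.subset_union_right)) (hXR A Set.subset_union_left)⟩
    _ ↔ Indep (coordSigma R (pre A)) (coordSigma R (pre B)) P :=
      condIndep_iff_indep_of_indep_sup (hsigX _) (hsig _) (hsig _) hindep
    _ ↔ ∀ u v : ↥(A ∪ B), (u : ι) ∈ A → (v : ι) ∉ A → (C⁻¹.submatrix Subtype.val Subtype.val)⁻¹ u v = 0 := by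
      rw [coordSigma_eq_comap, coordSigma_eq_comap]
      refine (indepFun_mulVec_iff hX hC (L.submatrix (Subtype.val : pre A → ↥(A ∪ B)) id)
        (L.submatrix (Subtype.val : pre B → ↥(A ∪ B)) id)).trans ?_
      have e : L.submatrix (Subtype.val : pre A → ↥(A ∪ B)) id * C *
          (L.submatrix (Subtype.val : pre B → ↥(A ∪ B)) id).transpose =
          (C⁻¹.submatrix Subtype.val Subtype.val)⁻¹.submatrix Subtype.val Subtype.val := by
        rw [← hLCL]
        rfl
      rw [e, ← Matrix.ext_iff]
      refine ⟨fun h u v hu hv => h ⟨u, hu⟩ ⟨v, v.2.resolve_left hv⟩, fun h u v => ?_⟩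
      exact h u v u.2 (hAB.notMem_of_mem_right v.2)
    _ ↔ ∀ u v : ↥(A ∪ B), (u : ι) ∈ A → (v : ι) ∉ A → C⁻¹ u v = 0 :=
      Matrix.inv_apply_eq_zero_iff_block hQ _
    _ ↔ ∀ a ∈ A, ∀ b ∈ B, C⁻¹ a b = 0 :=
      ⟨fun h a ha b hb => h ⟨a, .inl ha⟩ ⟨b, .inr hb⟩ ha (hAB.notMem_of_mem_right hb),
        fun h u v hu hv => h u hu v (v.2.resolve_left hv)⟩

end Gaussian

section Sequence

variable [MeasurableSpace Ω] {N d : ℕ}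

lemma IsGaussianVec.hasGaussianLaw {ι : Type*} [Fintype ι] {X : Ω → ι → ℝ} {P : Measure Ω}
    (hXm : Measurable X) (hX : IsGaussianVec X P) : HasGaussianLaw X P where
  isGaussian_map := by
    classical
    refine isGaussian_of_isGaussian_map fun L => ?_
    obtain ⟨m, v, h⟩ := hX fun i => L (Pi.single i 1)
    have e : (fun ω => ∑ i, L (Pi.single i 1) * X ω i) = L ∘ X := by
      funext ω
      conv_rhs => rw [Function.comp_apply, pi_eq_sum_univ' (X ω), map_sum]
      simp [mul_comm]
    rw [Measure.map_map L.continuous.measurable hXm, ← e, h]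
    infer_instance

lemma sigmaOf_eq_coordSigma (x : ℕ → Ω → (Fin d → ℝ)) {S : Set ℕ} (hS : ∀ k ∈ S, k ≤ N) :
    sigmaOf x S = coordSigma (fun (p : Fin (N + 1) × Fin d) ω => x p.1 ω p.2)
      {p | (p.1 : ℕ) ∈ S} := by
  refine le_antisymm (iSup₂_le fun k hk => Measurable.comap_le ?_)
    (coordSigma_le fun p hp => ?_)
  · exact @measurable_pi_lambda _ _ _ (coordSigma _ _) _ _ fun i =>
      measurable_coordSigma (fun (p : Fin (N + 1) × Fin d) ω => x p.1 ω p.2)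
        (i := (⟨k, Nat.lt_succ_of_le (hS k hk)⟩, i)) hk
  · have : Measurable[sigmaOf x S] (x p.1) := Measurable.of_comap_le (le_iSup₂_of_le _ hp le_rfl)
    exact (measurable_pi_apply p.2).comp this

end Sequence

/-- a nonsingular Gaussian sequence with covariance matrix `C` is `CM_F`
iff `C⁻¹` has the `CM_F` form: its `d × d` blocks `(C⁻¹)_{i,j}` vanish whenever
`|i − j| ≥ 2` and `0 ∉ {i, j}`. -/
theorem stmt_11 [MeasurableSpace Ω] [StandardBorelSpace Ω]
    (N d : ℕ) (hN : 2 ≤ N) (hd : 1 ≤ d)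
    (P : Measure Ω) [IsProbabilityMeasure P]
    (x : ℕ → Ω → (Fin d → ℝ)) (hx : ∀ k, Measurable (x k))
    (hG : IsGaussianVec (stacked N x) P)
    (C : Matrix (Fin (N + 1) × Fin d) (Fin (N + 1) × Fin d) ℝ)
    (hC : ∀ p q, C p q = ∫ ω, (x p.1 ω p.2 - ∫ ω', x p.1 ω' p.2 ∂P) *
      (x q.1 ω q.2 - ∫ ω', x q.1 ω' q.2 ∂P) ∂P)
    (hCpd : C.PosDef) :
    IsCM N 0 P x hx ↔
      ∀ i, ∀ hi : i ≤ N, ∀ j, ∀ hj : j ≤ N,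
        (i + 2 ≤ j ∨ j + 2 ≤ i) → i ≠ 0 → j ≠ 0 →
        ∀ a b, C⁻¹ (⟨i, by omega⟩, a) (⟨j, by omega⟩, b) = 0 := by
  classical
  let X : Fin (N + 1) × Fin d → Ω → ℝ := fun p ω => x p.1 ω p.2
  have hXm (p) : Measurable (X p) := (measurable_pi_apply p.2).comp (hx p.1)
  have hX : HasGaussianLaw (fun ω p => X p ω) P :=
    hG.hasGaussianLaw (measurable_pi_lambda _ hXm)
  have hj (j : ℕ) (hj : j ≤ N) : CondIndep (sigmaOf x {j, 0})
      (sigmaOf x {k | j < k ∧ k ≤ N ∧ k ≠ 0}) (sigmaOf x {k | k < j ∧ k ≠ 0})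
      (sigmaOf_le hx _) P ↔
      ∀ p q : Fin (N + 1) × Fin d, (j < (p.1 : ℕ) ∧ (p.1 : ℕ) ≤ N ∧ (p.1 : ℕ) ≠ 0) →
        ((q.1 : ℕ) < j ∧ (q.1 : ℕ) ≠ 0) → C⁻¹ p q = 0 := by
    let A : Set (Fin (N + 1) × Fin d) := {p | (p.1 : ℕ) ∈ {k | j < k ∧ k ≤ N ∧ k ≠ 0}}
    let B : Set (Fin (N + 1) × Fin d) := {p | (p.1 : ℕ) ∈ {k | k < j ∧ k ≠ 0}}
    have hAB : Disjoint A B := Set.disjoint_left.2 fun p hp hq => by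
      simp only [A, B, Set.mem_ofPred_eq] at hp hq
      omega
    have e0 : {p : Fin (N + 1) × Fin d | (p.1 : ℕ) ∈ ({j, 0} : Set ℕ)} = (A ∪ B)ᶜ := by
      ext p
      have := p.1.is_le
      simp only [A, B, Set.mem_ofPred_eq, Set.mem_insert_iff, Set.mem_singleton_iff,
        Set.mem_compl_iff, Set.mem_union]
      omega
    have h0 := sigmaOf_eq_coordSigma (N := N) x (S := {j, 0}) (by
      rintro k (rfl | rfl) <;> omega)
    have hA := sigmaOf_eq_coordSigma (N := N) x (S := {k | j < k ∧ k ≤ N ∧ k ≠ 0})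
      fun k hk => hk.2.1
    have hB := sigmaOf_eq_coordSigma (N := N) x (S := {k | k < j ∧ k ≠ 0})
      fun k hk => hk.1.le.trans hj
    rw [e0] at h0
    simp only [h0, hA, hB]
    exact (condIndep_coordSigma_iff_inv_eq_zero hXm hX hC hCpd hAB).trans
      ⟨fun h p q hp hq => h p hp q hq, fun h p hp q hq => h p q hp hq⟩
  refine (forall₂_congr hj).trans ⟨fun h i hi j hj hij hi0 hj0 a b => ?_,
    fun h j _ p q hp hq => ?_⟩
  · rcases hij with hij | hij
    · rw [← hCpd.inv.isHermitian.apply]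
      simpa using h (i + 1) (by omega) (⟨j, by omega⟩, b) (⟨i, by omega⟩, a)
        ⟨by simp only; omega, hj, hj0⟩ ⟨by simp only; omega, hi0⟩
    · exact h (j + 1) (by omega) (⟨i, by omega⟩, a) (⟨j, by omega⟩, b)
        ⟨by simp only; omega, hi, hi0⟩ ⟨by simp only; omega, hj0⟩
  · exact h p.1 hp.2.1 q.1 q.1.is_le (by omega) hp.2.2 hq.2 p.2 q.2
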